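/- arXiv:1708.03452 — 5 statements merged into one kernel-verified Lean document; each statement's English description precedes it below -/
import Mathlib

section
/- Let A = ![![1, 1], ![0, 1]] and B = ![![a, b], ![c, d]] be elements of SL(2, ℂ) (so ad − bc = 1). If the subgroup of SL(2, ℂ) generated by A and B is discrete (i.e., the subgroup closure of {A, B} carries the discrete topology as a subspace of SL(2, ℂ)), then c = 0 or |c| ≥ 1. -/
/-- `SL(2, ℂ)` carries the subspace topology induced from the `2 × 2` complex matrices. -/
noncomputable instance : TopologicalSpace (Matrix.SpecialLinearGroup (Fin 2) ℂ) :=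
  TopologicalSpace.induced (fun A => (A : Matrix (Fin 2) (Fin 2) ℂ)) inferInstance

open Filter Topology

/-- The explicit form of the conjugate of `!![1, 1; 0, 1]` by an element of `SL(2, ℂ)`. -/
theorem coe_conj_of_coe_eq_translation {A : Matrix.SpecialLinearGroup (Fin 2) ℂ}
    (hA : (A : Matrix (Fin 2) (Fin 2) ℂ) = !![1, 1; 0, 1])
    (X : Matrix.SpecialLinearGroup (Fin 2) ℂ) :
    ((X * A * X⁻¹ : Matrix.SpecialLinearGroup (Fin 2) ℂ) : Matrix (Fin 2) (Fin 2) ℂ) =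
      !![1 - X.1 0 0 * X.1 1 0, X.1 0 0 ^ 2; -X.1 1 0 ^ 2, 1 + X.1 0 0 * X.1 1 0] := by
  have hdet : X.1 0 0 * X.1 1 1 - X.1 0 1 * X.1 1 0 = 1 := by
    rw [← Matrix.det_fin_two, X.2]
  rw [Matrix.SpecialLinearGroup.coe_mul, Matrix.SpecialLinearGroup.coe_mul,
    Matrix.SpecialLinearGroup.coe_inv, hA, Matrix.adjugate_fin_two]
  ext i j
  fin_cases i <;> fin_cases j <;> simp [Matrix.mul_apply, Fin.sum_univ_two] <;>
    first | ring1 | linear_combination hdet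

/-- If `u` and `v` satisfy `u (n + 1) = 1 - u n * v n` and `v (n + 1) = -v n ^ 2` with
`‖v 0‖ < 1`, then `v` tends to `0` and `u` tends to `1`. -/
theorem tendsto_of_shimizu_recurrence {u v : ℕ → ℂ}
    (hu : ∀ n, u (n + 1) = 1 - u n * v n) (hv : ∀ n, v (n + 1) = -v n ^ 2) (h0 : ‖v 0‖ < 1) :
    Tendsto v atTop (𝓝 0) ∧ Tendsto u atTop (𝓝 1) := by
  have hv_le : ∀ n, ‖v n‖ ≤ ‖v 0‖ ^ (n + 1) := by
    intro n
    induction n with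
    | zero => simp
    | succ n ih =>
      calc ‖v (n + 1)‖ = ‖v n‖ ^ 2 := by rw [hv, norm_neg, norm_pow]
        _ ≤ (‖v 0‖ ^ (n + 1)) ^ 2 := by gcongr
        _ = ‖v 0‖ ^ ((n + 1) * 2) := by rw [pow_mul]
        _ ≤ ‖v 0‖ ^ (n + 1 + 1) := pow_le_pow_of_le_one (norm_nonneg _) h0.le (by omega)
  have hv_tendsto : Tendsto v atTop (𝓝 0) :=
    squeeze_zero_norm hv_le
      ((tendsto_pow_atTop_nhds_zero_of_lt_one (norm_nonneg _) h0).comp (tendsto_add_atTop_nat 1))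
  have hpos : 0 < 1 - ‖v 0‖ := sub_pos.2 h0
  obtain ⟨M, hM, hM1⟩ : ∃ M, ‖u 0‖ ≤ M ∧ 1 + M * ‖v 0‖ ≤ M := by
    refine ⟨max ‖u 0‖ (1 / (1 - ‖v 0‖)), le_max_left _ _, ?_⟩
    have := (div_le_iff₀ hpos).1 (le_max_right ‖u 0‖ (1 / (1 - ‖v 0‖)))
    linarith
  have hu_le : ∀ n, ‖u n‖ ≤ M := by
    intro n
    induction n with
    | zero => exact hM
    | succ n ih =>
      have hvn : ‖v n‖ ≤ ‖v 0‖ :=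
        (hv_le n).trans (pow_le_of_le_one (norm_nonneg _) h0.le n.succ_ne_zero)
      calc ‖u (n + 1)‖ ≤ ‖(1 : ℂ)‖ + ‖u n * v n‖ := by rw [hu]; exact norm_sub_le _ _
        _ = 1 + ‖u n‖ * ‖v n‖ := by rw [norm_one, norm_mul]
        _ ≤ 1 + M * ‖v 0‖ := by
          have := (norm_nonneg _).trans ih
          gcongr
        _ ≤ M := hM1
  have huv : Tendsto (fun n => u n * v n) atTop (𝓝 0) := by
    refine squeeze_zero_norm (a := fun n => M * ‖v n‖) (fun n => ?_) ?_
    · rw [norm_mul]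
      gcongr
      exact hu_le n
    · simpa using hv_tendsto.norm.const_mul M
  refine ⟨hv_tendsto, (tendsto_add_atTop_iff_nat 1).1 ?_⟩
  simpa [hu] using huv.const_sub 1

/-- If `A = !![1, 1; 0, 1]` and the lower left entry of `B` has norm less than `1`, then the
iterates of `X ↦ X * A * X⁻¹` starting at `B` converge to `A`. -/
theorem tendsto_iterate_conj_translation {A B : Matrix.SpecialLinearGroup (Fin 2) ℂ}
    (hA : (A : Matrix (Fin 2) (Fin 2) ℂ) = !![1, 1; 0, 1]) (hB : ‖B.1 1 0‖ < 1) :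
    Tendsto (fun n => (fun X => X * A * X⁻¹)^[n] B) atTop (𝓝 A) := by
  set S : ℕ → Matrix.SpecialLinearGroup (Fin 2) ℂ := fun n => (fun X => X * A * X⁻¹)^[n] B
  have hS (n : ℕ) : (S (n + 1)).1 = !![1 - (S n).1 0 0 * (S n).1 1 0, (S n).1 0 0 ^ 2;
      -(S n).1 1 0 ^ 2, 1 + (S n).1 0 0 * (S n).1 1 0] := by
    rw [← coe_conj_of_coe_eq_translation hA]
    simp only [S, Function.iterate_succ_apply']
  obtain ⟨hc, ha⟩ := tendsto_of_shimizu_recurrence (u := fun n => (S n).1 0 0)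
    (v := fun n => (S n).1 1 0) (fun n => by simp [hS]) (fun n => by simp [hS]) hB
  rw [← tendsto_add_atTop_iff_nat 1, nhds_induced, tendsto_comap_iff, hA]
  refine tendsto_pi_nhds.2 fun i => tendsto_pi_nhds.2 fun j => ?_
  simp only [Function.comp_def, hS]
  fin_cases i <;> fin_cases j
  · simpa using (ha.mul hc).const_sub 1
  · simpa using ha.pow 2
  · simpa using (hc.pow 2).neg
  · simpa using (ha.mul hc).const_add 1

/-- The Shimizu–Leutbecher lemma: if the subgroup of `SL(2, ℂ)` generated by
`A = !![1, 1; 0, 1]` and `B = !![a, b; c, d]` is discrete, then `c = 0` or `|c| ≥ 1`. -/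
theorem shimizu_leutbecher (a b c d : ℂ) (h : a * d - b * c = 1)
    (A B : Matrix.SpecialLinearGroup (Fin 2) ℂ)
    (hA : (A : Matrix (Fin 2) (Fin 2) ℂ) = !![1, 1; 0, 1])
    (hB : (B : Matrix (Fin 2) (Fin 2) ℂ) = !![a, b; c, d])
    (hdisc : DiscreteTopology ↥(Subgroup.closure ({A, B} :
      Set (Matrix.SpecialLinearGroup (Fin 2) ℂ)))) :
    c = 0 ∨ 1 ≤ ‖c‖ := by
  by_contra! hc
  obtain ⟨hc0, hc1⟩ := hc
  have hB10 : B.1 1 0 = c := by rw [hB]; simp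
  set S : ℕ → Matrix.SpecialLinearGroup (Fin 2) ℂ := fun n => (fun X => X * A * X⁻¹)^[n] B
  have hS_succ (n : ℕ) : S (n + 1) = S n * A * (S n)⁻¹ :=
    Function.iterate_succ_apply' _ _ _
  set H := Subgroup.closure ({A, B} : Set (Matrix.SpecialLinearGroup (Fin 2) ℂ))
  have hAH : A ∈ H := Subgroup.subset_closure (by simp)
  have hSH (n : ℕ) : S n ∈ H := by
    induction n with
    | zero => exact Subgroup.subset_closure (by simp [S])
    | succ n ih =>
      rw [hS_succ]
      exact H.mul_mem (H.mul_mem ih hAH) (H.inv_mem ih)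
  have hS_ne (n : ℕ) : (S n).1 1 0 ≠ 0 := by
    induction n with
    | zero => simpa [S, hB10] using hc0
    | succ n ih =>
      rw [hS_succ, coe_conj_of_coe_eq_translation hA]
      simpa using ih
  have hlim : Tendsto (fun n => (⟨S n, hSH n⟩ : H)) atTop (𝓝 ⟨A, hAH⟩) :=
    tendsto_subtype_rng.2 (tendsto_iterate_conj_translation hA (by rwa [hB10]))
  rw [nhds_discrete, tendsto_pure] at hlim
  obtain ⟨n, hn⟩ := hlim.exists
  refine hS_ne n ?_
  rw [Subtype.mk.inj hn, hA]
  simp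
end

section
/- Let A = ![![1, 2], ![0, 1]] and B = ![![a, b], ![c, d]] be elements of SL(2, ℂ) (so ad − bc = 1). If the subgroup of SL(2, ℂ) generated by A and B is discrete, then c = 0 or |c| ≥ 1/2. -/
open Filter Topology in
/-- The recursion satisfied by the first column of the iterated conjugates
`B ↦ B * A * B⁻¹` of the translation `A = !![1, 2; 0, 1]`: if `‖c 0‖ < 1 / 2`, then
`c` tends to `0` and `a` stays bounded, so that `a * c` tends to `0` too. -/
theorem tendsto_zero_of_conj_recursion {a c : ℕ → ℂ}
    (ha : ∀ n, a (n + 1) = 1 - 2 * (a n * c n)) (hc : ∀ n, c (n + 1) = -2 * c n ^ 2)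
    (h0 : ‖c 0‖ < 1 / 2) :
    Tendsto c atTop (𝓝 0) ∧ Tendsto (fun n => a n * c n) atTop (𝓝 0) := by
  set x : ℝ := 2 * ‖c 0‖ with hx
  have hx0 : 0 ≤ x := by positivity
  have hx1 : x < 1 := by linarith
  have hcx (n : ℕ) : 2 * ‖c n‖ ≤ x ^ (n + 1) := by
    induction n with
    | zero => simp [hx]
    | succ n ih =>
      calc 2 * ‖c (n + 1)‖ = (2 * ‖c n‖) ^ 2 := by rw [hc]; simp; ring
        _ ≤ (x ^ (n + 1)) ^ 2 := by gcongr
        _ = x ^ (2 * n + 2) := by ring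
        _ ≤ x ^ (n + 1 + 1) := pow_le_pow_of_le_one hx0 hx1.le (by omega)
  have hc0 : Tendsto c atTop (𝓝 0) := by
    refine squeeze_zero_norm (a := fun n => x ^ n) (fun n => ?_)
      (tendsto_pow_atTop_nhds_zero_of_lt_one hx0 hx1)
    have := hcx n
    have := pow_le_pow_of_le_one hx0 hx1.le (Nat.le_add_right n 1)
    have := norm_nonneg (c n)
    linarith
  have hbdd (n : ℕ) : ‖a n‖ ≤ max ‖a 0‖ (1 / (1 - x)) := by
    induction n with
    | zero => exact le_max_left _ _
    | succ n ih =>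
      set M := max ‖a 0‖ (1 / (1 - x))
      have hM : 1 ≤ M * (1 - x) := (div_le_iff₀ (by linarith)).1 (le_max_right _ _)
      have hcn : 2 * ‖c n‖ ≤ x :=
        (hcx n).trans (pow_le_of_le_one hx0 hx1.le n.succ_ne_zero)
      calc ‖a (n + 1)‖ ≤ ‖(1 : ℂ)‖ + ‖2 * (a n * c n)‖ := by rw [ha]; exact norm_sub_le _ _
        _ = 1 + ‖a n‖ * (2 * ‖c n‖) := by simp; ring
        _ ≤ 1 + M * x := by gcongr
        _ ≤ M := by linarith
  refine ⟨hc0, ?_⟩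
  refine squeeze_zero_norm (a := fun n => max ‖a 0‖ (1 / (1 - x)) * ‖c n‖) (fun n => ?_) ?_
  · rw [norm_mul]
    gcongr
    exact hbdd n
  · simpa using hc0.norm.const_mul (max ‖a 0‖ (1 / (1 - x)))

/-- The conjugate of the translation `A = !![1, 2; 0, 1]` by an element of `SL(2, ℂ)`. -/
theorem coe_conj_translation (A X : Matrix.SpecialLinearGroup (Fin 2) ℂ)
    (hA : (A : Matrix (Fin 2) (Fin 2) ℂ) = !![1, 2; 0, 1]) :
    ((X * A * X⁻¹ : Matrix.SpecialLinearGroup (Fin 2) ℂ) : Matrix (Fin 2) (Fin 2) ℂ) =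
      !![1 - 2 * (X 0 0 * X 1 0), 2 * X 0 0 ^ 2;
        -2 * X 1 0 ^ 2, 1 + 2 * (X 0 0 * X 1 0)] := by
  have hdet : X 0 0 * X 1 1 - X 0 1 * X 1 0 = 1 := by
    rw [← Matrix.det_fin_two, X.det_coe]
  rw [Matrix.SpecialLinearGroup.coe_mul, Matrix.SpecialLinearGroup.coe_mul,
    Matrix.SpecialLinearGroup.coe_inv, hA, Matrix.adjugate_fin_two]
  ext i j
  fin_cases i <;> fin_cases j <;> simp [Matrix.mul_apply, Fin.sum_univ_two]
  · linear_combination hdet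
  · ring
  · ring
  · linear_combination hdet

open Filter Topology in
/-- Conjugated form of the Shimizu–Leutbecher lemma: if the subgroup of `SL(2, ℂ)`
generated by `A = !![1, 2; 0, 1]` and `B = !![a, b; c, d]` is discrete,
then `c = 0` or `|c| ≥ 1/2`. -/
theorem shimizu_leutbecher_conjugated (a b c d : ℂ) (h : a * d - b * c = 1)
    (A B : Matrix.SpecialLinearGroup (Fin 2) ℂ)
    (hA : (A : Matrix (Fin 2) (Fin 2) ℂ) = !![1, 2; 0, 1])
    (hB : (B : Matrix (Fin 2) (Fin 2) ℂ) = !![a, b; c, d])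
    (hdisc : DiscreteTopology ↥(Subgroup.closure ({A, B} :
      Set (Matrix.SpecialLinearGroup (Fin 2) ℂ)))) :
    c = 0 ∨ 1 / 2 ≤ ‖c‖ := by
  by_contra! ⟨hc, hlt⟩
  let Γ := Subgroup.closure ({A, B} : Set (Matrix.SpecialLinearGroup (Fin 2) ℂ))
  let α : Γ := ⟨A, Subgroup.subset_closure (by simp)⟩
  let β : Γ := ⟨B, Subgroup.subset_closure (by simp)⟩
  let u : ℕ → Γ := fun n => (fun X => X * α * X⁻¹)^[n] β
  have hu (n : ℕ) : ((u (n + 1)).1 : Matrix (Fin 2) (Fin 2) ℂ) =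
      !![1 - 2 * ((u n).1 0 0 * (u n).1 1 0), 2 * (u n).1 0 0 ^ 2;
        -2 * (u n).1 1 0 ^ 2, 1 + 2 * ((u n).1 0 0 * (u n).1 1 0)] := by
    rw [← coe_conj_translation A _ hA]
    simp only [u, Function.iterate_succ_apply']
    rfl
  have ha (n : ℕ) : (u (n + 1)).1 0 0 = 1 - 2 * ((u n).1 0 0 * (u n).1 1 0) := by
    simp [hu]
  have hc' (n : ℕ) : (u (n + 1)).1 1 0 = -2 * (u n).1 1 0 ^ 2 := by
    simp [hu]
  have hu0 : (u 0).1 1 0 = c := by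
    simp [u, β, hB]
  have hne (n : ℕ) : (u n).1 1 0 ≠ 0 := by
    induction n with
    | zero => rwa [hu0]
    | succ n ih => simpa [hc'] using ih
  obtain ⟨hc_lim, hac_lim⟩ := tendsto_zero_of_conj_recursion (a := fun n => (u n).1 0 0)
    (c := fun n => (u n).1 1 0) ha hc' (by rwa [hu0])
  have ha_lim : Tendsto (fun n => (u n).1 0 0) atTop (𝓝 1) := by
    rw [← tendsto_add_atTop_iff_nat 1]
    simpa [ha] using (hac_lim.const_mul 2).const_sub 1
  have hlim : Tendsto (fun n => u (n + 1)) atTop (𝓝 α) := by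
    have hind : IsInducing
        (fun X : Matrix.SpecialLinearGroup (Fin 2) ℂ => (X : Matrix (Fin 2) (Fin 2) ℂ)) := ⟨rfl⟩
    rw [tendsto_subtype_rng, hind.tendsto_nhds_iff]
    refine tendsto_pi_nhds.2 fun i => tendsto_pi_nhds.2 fun j => ?_
    simp only [Function.comp_def, α, hu, hA]
    fin_cases i <;> fin_cases j
    · simpa using (hac_lim.const_mul 2).const_sub 1
    · simpa using (ha_lim.pow 2).const_mul 2
    · simpa using (hc_lim.pow 2).const_mul (-2)
    · simpa using (hac_lim.const_mul 2).const_add 1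
  rw [nhds_discrete, tendsto_pure] at hlim
  obtain ⟨n, hn⟩ := hlim.exists
  refine hne (n + 1) ?_
  rw [hn]
  simp [α, hA]
end

section
/- Let τ ∈ ℂ with Im τ > 0. Suppose the subgroup of SL(2, ℂ) generated by the four matrices x = ![![1, 2], ![0, 1]], y = ![![1, 0], ![2, 1]], z = ![![1, 2/τ], ![0, 1]], and w = ![![1, 0], ![2·τ, 1]] is discrete. Then for every pair of integers (m, n) ≠ (0, 0), one has |m·τ + n| ≥ 1/4 and |m/τ + n| ≥ 1/4. -/
open Filter Topology

namespace Matrix.SpecialLinearGroup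

theorem transvection_zpow {ι F : Type*} [DecidableEq ι] [Fintype ι] [CommRing F] {i j : ι}
    (hij : i ≠ j) (t : F) (n : ℤ) :
    transvection hij t ^ n = transvection hij (n * t) := by
  let f : Multiplicative F →* SpecialLinearGroup ι F :=
    { toFun := fun s => transvection hij s.toAdd
      map_one' := transvection_coeff_zero hij
      map_mul' := fun a b => transvection_add hij a.toAdd b.toAdd }
  have h := map_zpow f (Multiplicative.ofAdd t) n
  rw [← ofAdd_zsmul, zsmul_eq_mul] at h
  exact h.symm

theorem conj_transvection_coe {F : Type*} [CommRing F] {i j : Fin 2} (hij : i ≠ j) (t : F)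
    (A : SpecialLinearGroup (Fin 2) F) :
    (A * transvection hij t * A⁻¹) i i = 1 - A i i * (A j i * t) ∧
    (A * transvection hij t * A⁻¹) i j = A i i ^ 2 * t ∧
    (A * transvection hij t * A⁻¹) j i = -(A j i ^ 2 * t) ∧
    (A * transvection hij t * A⁻¹) j j = 1 + A i i * (A j i * t) := by
  have hdet := A.det_coe
  rw [Matrix.det_fin_two] at hdet
  fin_cases i <;> fin_cases j <;> first | exact absurd rfl hij | skip
  all_goals
    simp [Matrix.mul_apply, Fin.sum_univ_two, transvection_coe, Matrix.adjugate_fin_two]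
    refine ⟨?_, ?_, ?_, ?_⟩ <;> grind

theorem tendsto_nhds_of_entries {α : Type*} {l : Filter α} {i j : Fin 2} (hij : i ≠ j)
    {A : α → SpecialLinearGroup (Fin 2) ℂ} {B : SpecialLinearGroup (Fin 2) ℂ}
    (hii : Tendsto (fun a => A a i i) l (𝓝 (B i i)))
    (h_ij : Tendsto (fun a => A a i j) l (𝓝 (B i j)))
    (hji : Tendsto (fun a => A a j i) l (𝓝 (B j i)))
    (hjj : Tendsto (fun a => A a j j) l (𝓝 (B j j))) :
    Tendsto A l (𝓝 B) := by
  rw [nhds_induced, tendsto_comap_iff]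
  refine tendsto_pi_nhds.2 fun p => tendsto_pi_nhds.2 fun q => ?_
  fin_cases i <;> fin_cases j <;> first | exact absurd rfl hij | skip
  all_goals fin_cases p <;> fin_cases q <;> assumption

/-- The **Shimizu–Leutbecher lemma**: in a discrete subgroup of `SL(2, ℂ)` containing a
transvection by `t ≠ 0`, an opposite off-diagonal entry `c` is either zero or satisfies
`1 ≤ ‖c * t‖`. -/
theorem shimizu_leutbecher {G : Subgroup (SpecialLinearGroup (Fin 2) ℂ)} [DiscreteTopology G]
    {i j : Fin 2} (hij : i ≠ j) {t : ℂ} (ht : t ≠ 0) (hT : transvection hij t ∈ G)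
    {A : SpecialLinearGroup (Fin 2) ℂ} (hA : A ∈ G) (hc : A j i ≠ 0) :
    1 ≤ ‖A j i * t‖ := by
  by_contra! hlt
  set r := ‖A j i * t‖ with hr
  have hr0 : 0 ≤ r := norm_nonneg _
  let B : ℕ → SpecialLinearGroup (Fin 2) ℂ := fun n =>
    (fun C => C * transvection hij t * C⁻¹)^[n] A
  have hBsucc (n : ℕ) : B (n + 1) = B n * transvection hij t * (B n)⁻¹ :=
    Function.iterate_succ_apply' _ _ _
  have hBmem (n : ℕ) : B n ∈ G := by
    induction n with
    | zero => exact hA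
    | succ n ih => rw [hBsucc]; exact G.mul_mem (G.mul_mem ih hT) (G.inv_mem ih)
  have hii (n : ℕ) : B (n + 1) i i = 1 - B n i i * (B n j i * t) := by
    rw [hBsucc]; exact (conj_transvection_coe hij t (B n)).1
  have h_ij (n : ℕ) : B (n + 1) i j = B n i i ^ 2 * t := by
    rw [hBsucc]; exact (conj_transvection_coe hij t (B n)).2.1
  have hji (n : ℕ) : B (n + 1) j i = -(B n j i ^ 2 * t) := by
    rw [hBsucc]; exact (conj_transvection_coe hij t (B n)).2.2.1
  have hjj (n : ℕ) : B (n + 1) j j = 1 + B n i i * (B n j i * t) := by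
    rw [hBsucc]; exact (conj_transvection_coe hij t (B n)).2.2.2
  have hne (n : ℕ) : B n j i ≠ 0 := by
    induction n with
    | zero => exact hc
    | succ n ih => rw [hji]; exact neg_ne_zero.2 (mul_ne_zero (pow_ne_zero 2 ih) ht)
  have hu (n : ℕ) : ‖B n j i * t‖ ≤ r ^ (n + 1) := by
    induction n with
    | zero => simp [B, hr]
    | succ n ih =>
      have h : B (n + 1) j i * t = -((B n j i * t) * (B n j i * t)) := by rw [hji]; ring
      have ih' : ‖B n j i * t‖ ≤ r :=
        ih.trans (pow_le_of_le_one hr0 hlt.le n.succ_ne_zero)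
      rw [h, norm_neg, norm_mul, pow_succ]
      exact mul_le_mul ih ih' (norm_nonneg _) (by positivity)
  have hu0 : Tendsto (fun n => B n j i * t) atTop (𝓝 0) :=
    squeeze_zero_norm hu
      ((tendsto_pow_atTop_nhds_zero_of_lt_one hr0 hlt).comp (tendsto_add_atTop_nat 1))
  have hbdd (n : ℕ) : ‖B n i i‖ ≤ ‖A i i‖ + (1 - r)⁻¹ := by
    have hinv : (1 - r) * (1 - r)⁻¹ = 1 := mul_inv_cancel₀ (by linarith)
    have hinv0 : 0 ≤ (1 - r)⁻¹ := inv_nonneg.2 (by linarith)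
    induction n with
    | zero => simpa [B] using hlt.le
    | succ n ih =>
      have hur : ‖B n j i * t‖ ≤ r :=
        (hu n).trans (pow_le_of_le_one hr0 hlt.le n.succ_ne_zero)
      calc ‖B (n + 1) i i‖ ≤ 1 + ‖B n i i‖ * ‖B n j i * t‖ := by
            rw [hii, ← norm_mul]
            exact (norm_sub_le _ _).trans (by simp)
        _ ≤ 1 + (‖A i i‖ + (1 - r)⁻¹) * r := by gcongr
        _ ≤ ‖A i i‖ + (1 - r)⁻¹ := by nlinarith [norm_nonneg (A i i)]
  have hprod : Tendsto (fun n => B n i i * (B n j i * t)) atTop (𝓝 0) := by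
    refine squeeze_zero_norm (a := fun n => (‖A i i‖ + (1 - r)⁻¹) * ‖B n j i * t‖)
      (fun n => ?_) ?_
    · rw [norm_mul]
      exact mul_le_mul_of_nonneg_right (hbdd n) (norm_nonneg _)
    · simpa using hu0.norm.const_mul (‖A i i‖ + (1 - r)⁻¹)
  have hlim_ii : Tendsto (fun n => B n i i) atTop (𝓝 1) := by
    rw [← tendsto_add_atTop_iff_nat 1]
    simpa [hii] using hprod.const_sub 1
  have hlim : Tendsto B atTop (𝓝 (transvection hij t)) := by
    refine tendsto_nhds_of_entries hij ?_ ?_ ?_ ?_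
    · simpa [transvection_coe, hij, hij.symm] using hlim_ii
    · rw [← tendsto_add_atTop_iff_nat 1]
      simpa [transvection_coe, hij, hij.symm, h_ij] using (hlim_ii.pow 2).mul_const t
    · simpa [transvection_coe, hij, hij.symm, ht] using hu0.mul_const t⁻¹
    · rw [← tendsto_add_atTop_iff_nat 1]
      simpa [transvection_coe, hij, hij.symm, hjj] using hprod.const_add 1
  have hlimG : Tendsto (fun n => (⟨B n, hBmem n⟩ : G)) atTop (𝓝 ⟨_, hT⟩) :=
    tendsto_subtype_rng.2 hlim
  rw [nhds_discrete, tendsto_pure] at hlimG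
  obtain ⟨n, hn⟩ := hlimG.exists
  apply hne n
  rw [show B n = transvection hij t from congrArg Subtype.val hn]
  simp [transvection_coe, hij, hij.symm]

theorem one_le_norm_mul_of_transvection_mem {G : Subgroup (SpecialLinearGroup (Fin 2) ℂ)}
    [DiscreteTopology G] {i j : Fin 2} (hij : i ≠ j) {s t : ℂ} (hs : s ≠ 0) (ht : t ≠ 0)
    (hS : transvection hij.symm s ∈ G) (hT : transvection hij t ∈ G) : 1 ≤ ‖s * t‖ := by
  have h : transvection hij.symm s j i = s := by
    simp [transvection_coe, hij.symm]
  simpa only [h] using shimizu_leutbecher hij ht hT hS (by rwa [h])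

end Matrix.SpecialLinearGroup

theorem Complex.intCast_mul_add_intCast_ne_zero {τ : ℂ} (hτ : 0 < τ.im) {m n : ℤ}
    (h : (m, n) ≠ (0, 0)) : (m : ℂ) * τ + n ≠ 0 := by
  intro h0
  have him := congrArg Complex.im h0
  have hm : m = 0 := by simpa [hτ.ne'] using him
  subst hm
  exact h (by simpa using h0)

/-- Matrix form of Proposition 5.3: if the subgroup of `SL(2, ℂ)` generated by
`x = !![1, 2; 0, 1]`, `y = !![1, 0; 2, 1]`, `z = !![1, 2/τ; 0, 1]`, and
`w = !![1, 0; 2·τ, 1]` is discrete, where `Im τ > 0`, then for all integers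
`(m, n) ≠ (0, 0)` one has `|m·τ + n| ≥ 1/4` and `|m/τ + n| ≥ 1/4`. -/
theorem modulus_bound_of_discrete (τ : ℂ) (hτ : 0 < τ.im)
    (x y z w : Matrix.SpecialLinearGroup (Fin 2) ℂ)
    (hx : (x : Matrix (Fin 2) (Fin 2) ℂ) = !![1, 2; 0, 1])
    (hy : (y : Matrix (Fin 2) (Fin 2) ℂ) = !![1, 0; 2, 1])
    (hz : (z : Matrix (Fin 2) (Fin 2) ℂ) = !![1, 2 / τ; 0, 1])
    (hw : (w : Matrix (Fin 2) (Fin 2) ℂ) = !![1, 0; 2 * τ, 1])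
    (hdisc : DiscreteTopology ↥(Subgroup.closure ({x, y, z, w} :
      Set (Matrix.SpecialLinearGroup (Fin 2) ℂ)))) :
    ∀ m n : ℤ, (m, n) ≠ (0, 0) →
      1 / 4 ≤ ‖(m : ℂ) * τ + (n : ℂ)‖ ∧
      1 / 4 ≤ ‖(m : ℂ) / τ + (n : ℂ)‖ := by
  open Matrix.SpecialLinearGroup in
  intro m n hmn
  have hτ0 : τ ≠ 0 := by rintro rfl; simp at hτ
  set G := Subgroup.closure ({x, y, z, w} : Set (Matrix.SpecialLinearGroup (Fin 2) ℂ))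
  have h01 : (0 : Fin 2) ≠ 1 := by decide
  have hx' : transvection h01 2 = x := by
    ext p q; rw [hx]
    fin_cases p <;> fin_cases q <;> simp [transvection_coe]
  have hz' : transvection h01 (2 / τ) = z := by
    ext p q; rw [hz]
    fin_cases p <;> fin_cases q <;> simp [transvection_coe]
  have hy' : transvection h01.symm 2 = y := by
    ext p q; rw [hy]
    fin_cases p <;> fin_cases q <;> simp [transvection_coe]
  have hw' : transvection h01.symm (2 * τ) = w := by
    ext p q; rw [hw]
    fin_cases p <;> fin_cases q <;> simp [transvection_coe]
  have hxG : transvection h01 2 ∈ G := hx' ▸ Subgroup.subset_closure (by simp)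
  have hyG : transvection h01.symm 2 ∈ G := hy' ▸ Subgroup.subset_closure (by simp)
  have hzG : transvection h01 (2 / τ) ∈ G := hz' ▸ Subgroup.subset_closure (by simp)
  have hwG : transvection h01.symm (2 * τ) ∈ G := hw' ▸ Subgroup.subset_closure (by simp)
  have key {p q : Fin 2} (hpq : p ≠ q) {v b : ℂ} (hb : b ≠ 0)
      (h₁ : transvection hpq.symm 2 ∈ G) (h₂ : transvection hpq 2 ∈ G)
      (h₃ : transvection hpq v ∈ G) (hv : (m : ℂ) * v + n * 2 = 2 * b) : 1 / 4 ≤ ‖b‖ := by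
    have hmem := G.mul_mem (G.zpow_mem h₃ m) (G.zpow_mem h₂ n)
    rw [transvection_zpow, transvection_zpow, ← transvection_add, hv] at hmem
    have h := one_le_norm_mul_of_transvection_mem hpq two_ne_zero
      (mul_ne_zero two_ne_zero hb) h₁ hmem
    simp only [norm_mul, Complex.norm_ofNat] at h
    linarith
  constructor
  · exact key h01.symm (Complex.intCast_mul_add_intCast_ne_zero hτ hmn) hxG hyG hwG (by ring)
  · have hne : (m : ℂ) / τ + n ≠ 0 := by
      have h := Complex.intCast_mul_add_intCast_ne_zero (m := n) (n := m) hτ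
        (by simpa [and_comm] using hmn)
      intro h0
      apply h
      field_simp at h0
      linear_combination h0
    exact key h01 hne hyG hxG hzG (by ring)
end

section
/- Let τ ∈ ℂ with Im τ > 0. If |m·τ + n| ≥ 1/4 and |m/τ + n| ≥ 1/4 for every pair of integers (m, n) ≠ (0, 0), then 1/4 ≤ |τ| ≤ 4 and 0.079 < arg τ < π − 0.079. -/
/-- If every nonzero vector of the lattice spanned by `1` and `x + iy` has length at least `1/4`
and `x` lies in `[0, 1]`, then the slope of `x + iy` is at least `0.0795`. -/
lemma slope_bound_of_nonneg {x y : ℝ} (hx : 0 ≤ x) (hx1 : x ≤ 1) (hy : 0 < y)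
    (H : ∀ m n : ℤ, (m, n) ≠ (0, 0) → 1 / 16 ≤ (m * x + n) ^ 2 + (m * y) ^ 2) :
    0.0795 * x ≤ y := by
  by_contra! hlt
  have hsq : y ^ 2 ≤ 0.00632025 * x ^ 2 := by nlinarith
  have h10 := H 1 0 (by simp)
  have h41 := H 4 (-1) (by simp)
  have h31 := H 3 (-1) (by simp)
  have h21 := H 2 (-1) (by simp)
  have h32 := H 3 (-2) (by simp)
  have h43 := H 4 (-3) (by simp)
  have h11 := H 1 (-1) (by simp)
  push_cast at h10 h41 h31 h21 h32 h43 h11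
  -- On each interval a single lattice vector is too short; convexity reduces this to endpoints.
  rcases le_total x 0.24 with h | h1
  · nlinarith [mul_nonneg hx (sub_nonneg.2 h)]
  rcases le_total x 0.26 with h | h2
  · nlinarith [mul_nonneg (sub_nonneg.2 h1) (sub_nonneg.2 h)]
  rcases le_total x 0.4 with h | h3
  · nlinarith [mul_nonneg (sub_nonneg.2 h2) (sub_nonneg.2 h)]
  rcases le_total x 0.6 with h | h4
  · nlinarith [mul_nonneg (sub_nonneg.2 h3) (sub_nonneg.2 h)]
  rcases le_total x 0.7265 with h | h5
  · nlinarith [mul_nonneg (sub_nonneg.2 h4) (sub_nonneg.2 h)]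
  rcases le_total x 0.758 with h | h6
  · nlinarith [mul_nonneg (sub_nonneg.2 h5) (sub_nonneg.2 h)]
  nlinarith [mul_nonneg (sub_nonneg.2 h6) (sub_nonneg.2 hx1)]

/-- If `|w| ≤ 1`, `w` is not real and every nonzero vector of the lattice `ℤw + ℤ` has length at
least `1/4`, then `|Im w| ≥ 0.0795 |Re w|`. -/
lemma abs_slope_bound {w : ℂ} (hw : ‖w‖ ≤ 1) (him : w.im ≠ 0)
    (H : ∀ m n : ℤ, (m, n) ≠ (0, 0) → 1 / 4 ≤ ‖(m : ℂ) * w + n‖) :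
    0.0795 * |w.re| ≤ |w.im| := by
  refine slope_bound_of_nonneg (abs_nonneg _) ((Complex.abs_re_le_norm w).trans hw)
    (abs_pos.2 him) fun m n hmn => ?_
  have key : ∀ m n : ℤ, (m, n) ≠ (0, 0) →
      1 / 16 ≤ (m * w.re + n) ^ 2 + (m * w.im) ^ 2 := by
    intro m n hmn
    have h2 : ‖(m : ℂ) * w + n‖ ^ 2 = (m * w.re + n) ^ 2 + (m * w.im) ^ 2 := by
      rw [Complex.sq_norm, Complex.normSq_apply]
      simp
      ring
    nlinarith [H m n hmn]
  rw [mul_pow _ |w.im|, sq_abs, ← mul_pow]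
  rcases abs_choice w.re with h | h <;> rw [h]
  · exact key m n hmn
  · have := key (-m) n (by simpa using hmn)
    push_cast at this
    linarith

lemma lt_angle_of_slope {φ : ℝ} (h0 : 0 ≤ φ)
    (h : 0.0795 * |Real.cos φ| ≤ Real.sin φ) : 0.079 < φ := by
  by_contra! hle
  nlinarith [Real.sin_le h0, Real.one_sub_sq_div_two_le_cos (x := φ), le_abs_self (Real.cos φ)]

/-- Explicit bounds of Proposition 5.3: if `Im τ > 0` and `|m·τ + n| ≥ 1/4` and
`|m/τ + n| ≥ 1/4` for all integers `(m, n) ≠ (0, 0)`, then `1/4 ≤ |τ| ≤ 4` and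
`0.079 < arg τ < π − 0.079`. -/
theorem modulus_region_bound (τ : ℂ) (hτ : 0 < τ.im)
    (h : ∀ m n : ℤ, (m, n) ≠ (0, 0) →
      1 / 4 ≤ ‖(m : ℂ) * τ + (n : ℂ)‖ ∧
      1 / 4 ≤ ‖(m : ℂ) / τ + (n : ℂ)‖) :
    1 / 4 ≤ ‖τ‖ ∧ ‖τ‖ ≤ 4 ∧
      (0.079 : ℝ) < τ.arg ∧ τ.arg < Real.pi - 0.079 := by
  have h0 : τ ≠ 0 := by
    rintro rfl
    simp at hτ
  have hpos : 0 < ‖τ‖ := norm_pos_iff.2 h0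
  obtain ⟨hlow, hinv⟩ := h 1 0 (by simp)
  have hslope : 0.0795 * |τ.re| ≤ |τ.im| := by
    rcases le_total ‖τ‖ 1 with h1 | h1
    · exact abs_slope_bound h1 hτ.ne' fun m n hmn => (h m n hmn).1
    · have hN : 0 < Complex.normSq τ := Complex.normSq_pos.2 h0
      have hs := abs_slope_bound (w := τ⁻¹) (by rw [norm_inv]; exact inv_le_one_of_one_le₀ h1)
        (by rw [Complex.inv_im]; exact div_ne_zero (neg_ne_zero.2 hτ.ne') hN.ne')
        fun m n hmn => by simpa [div_eq_mul_inv] using (h m n hmn).2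
      rw [Complex.inv_re, Complex.inv_im, abs_div, abs_div, abs_neg, abs_of_pos hN,
        ← mul_div_assoc] at hs
      exact (div_le_div_iff_of_pos_right hN).1 hs
  have hangle : 0.0795 * |Real.cos τ.arg| ≤ Real.sin τ.arg := by
    rw [Complex.cos_arg h0, Complex.sin_arg, abs_div, abs_of_pos hpos, ← mul_div_assoc]
    rw [abs_of_pos hτ] at hslope
    gcongr
  refine ⟨by simpa using hlow, ?_, lt_angle_of_slope (Complex.arg_nonneg_iff.2 hτ.le) hangle, ?_⟩
  · have hinv' : (4 : ℝ)⁻¹ ≤ ‖τ‖⁻¹ := by simpa using hinv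
    exact (inv_le_inv₀ (by norm_num) hpos).1 hinv'
  · have := lt_angle_of_slope (φ := Real.pi - τ.arg) (sub_nonneg.2 (Complex.arg_le_pi τ))
      (by rwa [Real.cos_pi_sub, Real.sin_pi_sub, abs_neg])
    linarith
end

section
/- Let τ ∈ ℂ with Im τ > 0. Then the following are equivalent: (a) for every pair of integers (m, n) ≠ (0, 0), |m·τ + n| ≥ 1/4 and |m/τ + n| ≥ 1/4; (b) the inequalities |m·τ + n| ≥ 1/4 and |m/τ + n| ≥ 1/4 hold for the fourteen pairs (m, n) = (1,0), (4,1), (4,−1), (3,1), (3,−1), (2,1), (2,−1), (3,2), (3,−2), (4,3), (4,−3), (1,1), (1,−1). -/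
/-- The semidisks of radius `1 / (4 q)` around the fractions `p / q ∈ [0, 1]` with `q ≤ 4` cover
the strip `0 ≤ x ≤ 1`, `y ^ 2 < 1 / 400`. -/
theorem sq_im_ge_of_nonneg_re {x y : ℝ} (hx0 : 0 ≤ x) (hx1 : x ≤ 1)
    (h10 : 1 / 16 ≤ x ^ 2 + y ^ 2)
    (h41 : 1 / 16 ≤ (4 * x - 1) ^ 2 + (4 * y) ^ 2)
    (h31 : 1 / 16 ≤ (3 * x - 1) ^ 2 + (3 * y) ^ 2)
    (h21 : 1 / 16 ≤ (2 * x - 1) ^ 2 + (2 * y) ^ 2)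
    (h32 : 1 / 16 ≤ (3 * x - 2) ^ 2 + (3 * y) ^ 2)
    (h43 : 1 / 16 ≤ (4 * x - 3) ^ 2 + (4 * y) ^ 2)
    (h11 : 1 / 16 ≤ (x - 1) ^ 2 + y ^ 2) :
    1 / 400 ≤ y ^ 2 := by
  rcases le_total x 0.242 with h | ha
  · nlinarith [mul_nonneg hx0 (sub_nonneg.2 h)]
  rcases le_total x 0.2735 with h | hb
  · nlinarith [mul_nonneg (sub_nonneg.2 ha) (sub_nonneg.2 h)]
  rcases le_total x 0.39 with h | hc
  · nlinarith [mul_nonneg (sub_nonneg.2 hb) (sub_nonneg.2 h)]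
  rcases le_total x 0.61 with h | hd
  · nlinarith [mul_nonneg (sub_nonneg.2 hc) (sub_nonneg.2 h)]
  rcases le_total x 0.7265 with h | he
  · nlinarith [mul_nonneg (sub_nonneg.2 hd) (sub_nonneg.2 h)]
  rcases le_total x 0.758 with h | hf
  · nlinarith [mul_nonneg (sub_nonneg.2 he) (sub_nonneg.2 h)]
  · nlinarith [mul_nonneg (sub_nonneg.2 hf) (sub_nonneg.2 hx1)]

/-- The pairs for which the inequalities have to be checked. -/
def criticalPairs : List (ℤ × ℤ) :=
  [(1, 0), (4, 1), (4, -1), (3, 1), (3, -1), (2, 1), (2, -1),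
    (3, 2), (3, -2), (4, 3), (4, -3), (1, 1), (1, -1)]

theorem quarter_le_norm_iff (z : ℂ) (m n : ℤ) :
    1 / 4 ≤ ‖(m : ℂ) * z + n‖ ↔ 1 / 16 ≤ (m * z.re + n) ^ 2 + (m * z.im) ^ 2 := by
  rw [← abs_of_nonneg (norm_nonneg _), ← abs_of_pos (show (0 : ℝ) < 1 / 4 by norm_num),
    ← sq_le_sq, Complex.sq_norm, Complex.normSq_apply]
  norm_num [sq]

set_option maxHeartbeats 1000000 in
theorem quarter_le_norm_of_criticalPairs {z : ℂ} (hz : ‖z‖ ≤ 1)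
    (h : ∀ p ∈ criticalPairs, 1 / 4 ≤ ‖(p.1 : ℂ) * z + p.2‖)
    {m n : ℤ} (hmn : (m, n) ≠ (0, 0)) : 1 / 4 ≤ ‖(m : ℂ) * z + n‖ := by
  simp only [quarter_le_norm_iff] at h ⊢
  obtain ⟨hl, hu⟩ := abs_le.1 ((Complex.abs_re_le_norm z).trans hz)
  generalize z.re = x at *
  generalize z.im = y at *
  simp only [criticalPairs, List.forall_mem_cons, List.not_mem_nil, false_imp_iff,
    implies_true, and_true] at h
  push_cast at h
  obtain ⟨h10, h41, h41', h31, h31', h21, h21', h32, h32', h43, h43', h11, h11'⟩ := h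
  have hy : 1 / 400 ≤ y ^ 2 := by
    rcases le_total 0 x with hx | hx
    · apply sq_im_ge_of_nonneg_re hx hu <;> linarith
    · apply sq_im_ge_of_nonneg_re (x := -x) (by linarith) (by linarith) <;> linarith
  by_cases hm : 5 ≤ |m|
  · have hm' : (25 : ℝ) ≤ (m : ℝ) ^ 2 := by
      have : (5 : ℝ) ≤ |(m : ℝ)| := by exact_mod_cast hm
      rw [← sq_abs]
      nlinarith
    nlinarith [sq_nonneg (m * x + n)]
  by_cases hn : |m| + 1 ≤ |n|
  · have hn' : |(m : ℝ)| + 1 ≤ |(n : ℝ)| := by exact_mod_cast hn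
    have hmx : |m * x| ≤ |(m : ℝ)| := by
      rw [abs_mul]
      exact mul_le_of_le_one_right (abs_nonneg _) (abs_le.2 ⟨hl, hu⟩)
    have habs : 1 ≤ |m * x + n| := by
      have := abs_sub_abs_le_abs_sub (n : ℝ) (-(m * x))
      rw [abs_neg, sub_neg_eq_add, add_comm (n : ℝ)] at this
      linarith
    have : 1 ≤ (m * x + n) ^ 2 := by
      rw [← sq_abs]
      nlinarith
    nlinarith [sq_nonneg (m * y)]
  have hn4 : |n| ≤ |m| := by omega
  obtain ⟨hm1, hm2⟩ := abs_le.1 (show |m| ≤ 4 by omega)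
  interval_cases m <;> norm_num [abs_le] at hn4 <;> obtain ⟨hn1, hn2⟩ := hn4 <;>
    interval_cases n <;> first | exact absurd rfl hmn | (push_cast; linarith)

theorem norm_div_add_eq (τ : ℂ) (hτ : τ ≠ 0) (m n : ℂ) :
    ‖m / τ + n‖ * ‖τ‖ = ‖n * τ + m‖ := by
  rw [← norm_mul, add_mul, div_mul_cancel₀ _ hτ, add_comm]

/-- If all the nonzero lattice vectors for `z` in the unit disk have norm at least `1 / 4`, then
so do those for `z⁻¹`. -/
theorem quarter_le_norm_inv {z : ℂ} (hz : z ≠ 0) (hz1 : ‖z‖ ≤ 1)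
    (h : ∀ m n : ℤ, (m, n) ≠ (0, 0) → 1 / 4 ≤ ‖(m : ℂ) * z + n‖)
    {m n : ℤ} (hmn : (m, n) ≠ (0, 0)) : 1 / 4 ≤ ‖(m : ℂ) / z + n‖ := by
  have h1 := h n m (by simpa [and_comm] using hmn)
  rw [← norm_div_add_eq z hz] at h1
  exact h1.trans (mul_le_of_le_one_right (norm_nonneg _) hz1)

/-- Reduction in the proof of Proposition 5.3: for `τ` in the upper half-plane, the
inequalities `|m·τ + n| ≥ 1/4` and `|m/τ + n| ≥ 1/4` over all nonzero integer pairs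
`(m, n)` are equivalent to the same inequalities for the fourteen listed pairs. -/
theorem modulus_conditions_reduce_to_finitely_many (τ : ℂ) (hτ : 0 < τ.im) :
    (∀ m n : ℤ, (m, n) ≠ (0, 0) →
      1 / 4 ≤ ‖(m : ℂ) * τ + (n : ℂ)‖ ∧
      1 / 4 ≤ ‖(m : ℂ) / τ + (n : ℂ)‖) ↔
    (∀ p ∈ ([(1, 0), (4, 1), (4, -1), (3, 1), (3, -1), (2, 1), (2, -1),
        (3, 2), (3, -2), (4, 3), (4, -3), (1, 1), (1, -1)] : List (ℤ × ℤ)),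
      1 / 4 ≤ ‖(p.1 : ℂ) * τ + (p.2 : ℂ)‖ ∧
      1 / 4 ≤ ‖(p.1 : ℂ) / τ + (p.2 : ℂ)‖) := by
  have hτ0 : τ ≠ 0 := by
    rintro rfl
    simp at hτ
  constructor
  · intro h p hp
    refine h p.1 p.2 ?_
    rintro h0
    rw [Prod.mk.eta] at h0
    subst h0
    simp at hp
  · intro h
    rcases le_total ‖τ‖ 1 with h1 | h1
    · have key : ∀ m n : ℤ, (m, n) ≠ (0, 0) → 1 / 4 ≤ ‖(m : ℂ) * τ + n‖ := fun _ _ =>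
        quarter_le_norm_of_criticalPairs h1 fun p hp => (h p hp).1
      exact fun m n hmn => ⟨key m n hmn, quarter_le_norm_inv hτ0 h1 key hmn⟩
    · have h1' : ‖τ⁻¹‖ ≤ 1 := by
        rw [norm_inv]
        exact inv_le_one_of_one_le₀ h1
      have key : ∀ m n : ℤ, (m, n) ≠ (0, 0) → 1 / 4 ≤ ‖(m : ℂ) * τ⁻¹ + n‖ := fun _ _ =>
        quarter_le_norm_of_criticalPairs h1' fun p hp => by
          simpa only [div_eq_mul_inv] using (h p hp).2
      intro m n hmn
      have h2 := quarter_le_norm_inv (inv_ne_zero hτ0) h1' key hmn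
      rw [div_inv_eq_mul] at h2
      exact ⟨h2, by simpa only [div_eq_mul_inv] using key m n hmn⟩
end
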